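/- arXiv:math/0606428 — 5 statements merged into one kernel-verified Lean document; each statement's English description precedes it below -/
import Mathlib

section
/- Let z : ℝ → ℂ be a smooth map with ∂_φ z(φ₀) ≠ 0 and z(φ₀) = 0 at some point φ₀. Then the limit as φ → φ₀ of ⟨z(φ), ν(φ)⟩ / |z(φ)|² exists and equals (1/2)·k(φ₀), where k(φ₀) is the curvature of the curve at z(φ₀) = 0. -/
open Real Set

/-- Euclidean inner product on ℂ ≅ ℝ²: ⟨a,b⟩ = Re(conj a · b). -/
noncomputable def ip (a b : ℂ) : ℝ := a.re * b.re + a.im * b.im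

/-- Outward unit normal ν = (∂_φ v − i ∂_φ u)/√g of a regular curve z = u + iv. -/
noncomputable def nu (z : ℝ → ℂ) (φ : ℝ) : ℂ :=
  (‖deriv z φ‖)⁻¹ • (⟨(deriv z φ).im, -(deriv z φ).re⟩ : ℂ)

/-- Curvature k = (u'v'' − v'u'')/g^{3/2}. -/
noncomputable def curv (z : ℝ → ℂ) (φ : ℝ) : ℝ :=
  ((deriv z φ).re * (deriv (deriv z) φ).im -
    (deriv z φ).im * (deriv (deriv z) φ).re) / ‖deriv z φ‖ ^ 3

/-- f = k + (n−1)⟨z,ν⟩/|z|². -/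
noncomputable def fq (n : ℕ) (z : ℝ → ℂ) (φ : ℝ) : ℝ :=
  curv z φ + ((n : ℝ) - 1) * ip (z φ) (nu z φ) / ‖z φ‖ ^ 2

/-- Tangential Laplacian Δh = (1/√g)∂_φ(∂_φ h/√g) along the curve z. -/
noncomputable def lap (z : ℝ → ℂ) (h : ℝ → ℝ) (φ : ℝ) : ℝ :=
  (deriv (fun ψ => deriv h ψ / ‖deriv z ψ‖) φ) / ‖deriv z φ‖

/-- ⟨ν, e_r⟩ = ⟨z,ν⟩/|z|. -/
noncomputable def ner (z : ℝ → ℂ) (φ : ℝ) : ℝ := ip (z φ) (nu z φ) / ‖z φ‖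

open Filter Topology in
/-- For a curve through the origin, the determinant of position and velocity, divided by
the square of the parameter increment, tends to half the determinant of velocity and
acceleration. -/
lemma tendsto_wronskian_div_sq {z : ℝ → ℂ} {φ₀ : ℝ} (hz : ContDiff ℝ 2 z) (h0 : z φ₀ = 0) :
    Tendsto (fun φ => ((z φ).re * (deriv z φ).im - (z φ).im * (deriv z φ).re) / (φ - φ₀) ^ 2)
      (𝓝[≠] φ₀) (𝓝 (((deriv z φ₀).re * (deriv (deriv z) φ₀).im -
        (deriv z φ₀).im * (deriv (deriv z) φ₀).re) / 2)) := by
  have hz' : ContDiff ℝ 1 (deriv z) := hz.deriv' (n := 1)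
  have hcont : Continuous (deriv (deriv z)) := hz'.continuous_deriv le_rfl
  have d0 (φ : ℝ) : HasDerivAt z (deriv z φ) φ :=
    (hz.differentiable (by norm_num) φ).hasDerivAt
  have d1 (φ : ℝ) : HasDerivAt (deriv z) (deriv (deriv z) φ) φ :=
    (hz'.differentiable (by norm_num) φ).hasDerivAt
  have hre {f : ℝ → ℂ} {f' : ℂ} {x : ℝ} (h : HasDerivAt f f' x) :
      HasDerivAt (fun y => (f y).re) f'.re x :=
    Complex.reCLM.hasFDerivAt.comp_hasDerivAt x h
  have him {f : ℝ → ℂ} {f' : ℂ} {x : ℝ} (h : HasDerivAt f f' x) :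
      HasDerivAt (fun y => (f y).im) f'.im x :=
    Complex.imCLM.hasFDerivAt.comp_hasDerivAt x h
  have hslope : Tendsto (fun φ => (φ - φ₀)⁻¹ • z φ) (𝓝[≠] φ₀) (𝓝 (deriv z φ₀)) := by
    simpa [slope_fun_def, h0] using (d0 φ₀).tendsto_slope
  have hsecond : Tendsto (deriv (deriv z)) (𝓝[≠] φ₀) (𝓝 (deriv (deriv z) φ₀)) :=
    hcont.continuousAt.tendsto.mono_left nhdsWithin_le_nhds
  have hN (φ : ℝ) : HasDerivAt
      (fun φ => (z φ).re * (deriv z φ).im - (z φ).im * (deriv z φ).re)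
      ((z φ).re * (deriv (deriv z) φ).im - (z φ).im * (deriv (deriv z) φ).re) φ :=
    (((hre (d0 φ)).mul (him (d1 φ))).sub ((him (d0 φ)).mul (hre (d1 φ)))).congr_deriv (by ring)
  have hD (φ : ℝ) : HasDerivAt (fun φ => (φ - φ₀) ^ 2) (2 * (φ - φ₀)) φ := by
    simpa using ((hasDerivAt_id φ).sub_const φ₀).fun_pow 2
  have hne : ∀ᶠ φ in 𝓝[≠] φ₀, φ - φ₀ ≠ 0 := by
    filter_upwards [self_mem_nhdsWithin] with φ hφ using sub_ne_zero.2 hφ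
  refine HasDerivAt.lhopital_zero_nhdsNE (.of_forall hN) (.of_forall hD)
    (hne.mono fun φ hφ => mul_ne_zero two_ne_zero hφ) ?_ ?_ ?_
  · simpa [h0] using (hN φ₀).continuousAt.tendsto.mono_left nhdsWithin_le_nhds
  · simpa using (hD φ₀).continuousAt.tendsto.mono_left nhdsWithin_le_nhds
  · have hre' := (Complex.continuous_re.tendsto _).comp hslope
    have him' := (Complex.continuous_im.tendsto _).comp hslope
    have hre'' := (Complex.continuous_re.tendsto _).comp hsecond
    have him'' := (Complex.continuous_im.tendsto _).comp hsecond
    refine (((hre'.mul him'').sub (him'.mul hre'')).div_const 2).congr' ?_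
    filter_upwards [hne] with φ hφ
    simp only [Function.comp_apply, Complex.smul_re, Complex.smul_im, smul_eq_mul]
    field_simp

/-- If z is a smooth curve with z(φ₀) = 0 and ∂_φ z(φ₀) ≠ 0, then
⟨z,ν⟩/|z|² tends to (1/2)·k(φ₀) as φ → φ₀. -/
theorem limit_at_origin (z : ℝ → ℂ) (φ₀ : ℝ)
    (hsm : ContDiff ℝ (⊤ : ℕ∞) z) (hreg : deriv z φ₀ ≠ 0) (h0 : z φ₀ = 0) :
    Filter.Tendsto (fun φ => ip (z φ) (nu z φ) / ‖z φ‖ ^ 2)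
      (nhdsWithin φ₀ {φ₀}ᶜ) (nhds ((1 / 2) * curv z φ₀)) := by
  have hz : ContDiff ℝ 2 z := contDiff_infty.1 hsm 2
  have hd : HasDerivAt z (deriv z φ₀) φ₀ := (hz.differentiable (by norm_num) φ₀).hasDerivAt
  have hnorm : Filter.Tendsto (fun φ => ‖(φ - φ₀)⁻¹ • z φ‖ ^ 2)
      (nhdsWithin φ₀ {φ₀}ᶜ) (nhds (‖deriv z φ₀‖ ^ 2)) := by
    simpa [slope_fun_def, h0] using hd.tendsto_slope.norm.pow 2
  have hspeed : Filter.Tendsto (fun φ => ‖deriv z φ‖) (nhdsWithin φ₀ {φ₀}ᶜ)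
      (nhds ‖deriv z φ₀‖) :=
    (hz.continuous_deriv (by norm_num)).norm.continuousAt.tendsto.mono_left nhdsWithin_le_nhds
  have hne : ‖deriv z φ₀‖ ≠ 0 := norm_ne_zero_iff.2 hreg
  have hlim := (tendsto_wronskian_div_sq hz h0).div (hspeed.mul hnorm)
    (mul_ne_zero hne (pow_ne_zero 2 hne))
  have hval : (1 / 2) * curv z φ₀ = ((deriv z φ₀).re * (deriv (deriv z) φ₀).im -
      (deriv z φ₀).im * (deriv (deriv z) φ₀).re) / 2 / (‖deriv z φ₀‖ * ‖deriv z φ₀‖ ^ 2) := by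
    simp only [curv]
    field_simp
  rw [hval]
  refine hlim.congr' ?_
  filter_upwards [self_mem_nhdsWithin] with φ hφ
  have hsub : φ - φ₀ ≠ 0 := sub_ne_zero.2 hφ
  have hip : ip (z φ) (nu z φ) =
      ((z φ).re * (deriv z φ).im - (z φ).im * (deriv z φ).re) / ‖deriv z φ‖ := by
    simp only [ip, nu, Complex.smul_re, Complex.smul_im, smul_eq_mul]
    ring
  rw [Pi.div_apply, hip, norm_smul, mul_pow, norm_inv, inv_pow, Real.norm_eq_abs, sq_abs, div_div,
    div_div]
  congr 1
  field_simp
end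

section
/- Let n ≥ 2 and let z = u + iv : ℝ → ℂ \ {0} be a continuous 2π-periodic map that is injective on [0,2π) (i.e. an embedded closed curve γ := z([0,2π))). Define F : ℝ × S^{n−1} → ℝⁿ × ℝⁿ by F(φ,p) := (u(φ)·p, v(φ)·p), where S^{n−1} ⊂ ℝⁿ is the unit sphere. Then F, regarded as a map on [0,2π) × S^{n−1}, is injective if and only if γ ∩ (−γ) = ∅; moreover if γ = −γ then F is exactly two-to-one: F(φ₁,p₁) = F(φ₂,p₂) holds for (φ₁,p₁) ≠ (φ₂,p₂) (φᵢ ∈ [0,2π)) exactly when p₂ = −p₁ and z(φ₂) = −z(φ₁). -/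
open Real Set

/-- Two points `(u₁ p₁, v₁ p₁)` and `(u₂ p₂, v₂ p₂)` with `p₁`, `p₂` unit vectors and
`u₁ + i v₁ ≠ 0` agree iff the data `(u + i v, p)` agree up to a common sign. -/
theorem re_smul_im_smul_eq_iff {E : Type*} [NormedAddCommGroup E] [NormedSpace ℝ E]
    {a b : ℂ} (ha : a ≠ 0) {p q : E} (hp : ‖p‖ = 1) (hq : ‖q‖ = 1) :
    (a.re • p, a.im • p) = (b.re • q, b.im • q) ↔ (a = b ∧ p = q) ∨ (b = -a ∧ q = -p) := by
  have hq0 : q ≠ 0 := by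
    rintro rfl
    simp at hq
  constructor
  · intro h
    obtain ⟨h₁, h₂⟩ := Prod.mk.inj h
    obtain ⟨c, rfl⟩ : ∃ c : ℝ, p = c • q := by
      by_cases hre : a.re = 0
      · have him : a.im ≠ 0 := fun him => ha (Complex.ext hre him)
        exact ⟨a.im⁻¹ * b.im, by rw [mul_smul, ← h₂, inv_smul_smul₀ him]⟩
      · exact ⟨a.re⁻¹ * b.re, by rw [mul_smul, ← h₁, inv_smul_smul₀ hre]⟩
    rw [smul_smul] at h₁ h₂
    have hre := smul_left_injective ℝ hq0 h₁
    have him := smul_left_injective ℝ hq0 h₂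
    rw [norm_smul, hq, mul_one, Real.norm_eq_abs] at hp
    rcases eq_or_eq_neg_of_abs_eq hp with rfl | rfl
    · exact Or.inl ⟨Complex.ext (by simpa using hre) (by simpa using him), one_smul ℝ q⟩
    · exact Or.inr ⟨Complex.ext (by simpa using hre.symm) (by simpa using him.symm), by simp⟩
  · rintro (⟨rfl, rfl⟩ | ⟨rfl, rfl⟩) <;> simp

/-- For an embedded closed curve γ = z([0,2π)) in ℂ \ {0}, the equivariant map
F(φ,p) = (u(φ)p, v(φ)p) is injective on [0,2π) × S^{n−1} iff γ ∩ (−γ) = ∅;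
moreover if γ = −γ then F is exactly two-to-one: for distinct pairs,
F(φ₁,p₁) = F(φ₂,p₂) holds exactly when p₂ = −p₁ and z(φ₂) = −z(φ₁). -/
theorem equivariant_embedded_iff (n : ℕ) (hn : 2 ≤ n) (z : ℝ → ℂ)
    (hcont : Continuous z) (hper : ∀ φ, z (φ + 2 * π) = z φ)
    (hnz : ∀ φ, z φ ≠ 0) (hinj : InjOn z (Ico 0 (2 * π))) :
    (InjOn (fun q : ℝ × EuclideanSpace ℝ (Fin n) => ((z q.1).re • q.2, (z q.1).im • q.2))
        ((Ico 0 (2 * π)) ×ˢ Metric.sphere (0 : EuclideanSpace ℝ (Fin n)) 1) ↔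
      (z '' Ico 0 (2 * π)) ∩ ((fun w => -w) '' (z '' Ico 0 (2 * π))) = ∅) ∧
    ((z '' Ico 0 (2 * π)) = (fun w => -w) '' (z '' Ico 0 (2 * π)) →
      ∀ φ₁ ∈ Ico 0 (2 * π), ∀ φ₂ ∈ Ico 0 (2 * π),
      ∀ p₁ ∈ Metric.sphere (0 : EuclideanSpace ℝ (Fin n)) 1,
      ∀ p₂ ∈ Metric.sphere (0 : EuclideanSpace ℝ (Fin n)) 1,
        ((φ₁, p₁) : ℝ × EuclideanSpace ℝ (Fin n)) ≠ (φ₂, p₂) →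
        ((((z φ₁).re • p₁, (z φ₁).im • p₁) :
            EuclideanSpace ℝ (Fin n) × EuclideanSpace ℝ (Fin n)) =
          ((z φ₂).re • p₂, (z φ₂).im • p₂) ↔ p₂ = -p₁ ∧ z φ₂ = -z φ₁)) := by
  have key : ∀ φ₁ φ₂ : ℝ, ∀ p₁ ∈ Metric.sphere (0 : EuclideanSpace ℝ (Fin n)) 1,
      ∀ p₂ ∈ Metric.sphere (0 : EuclideanSpace ℝ (Fin n)) 1,
      ((z φ₁).re • p₁, (z φ₁).im • p₁) = ((z φ₂).re • p₂, (z φ₂).im • p₂) ↔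
        (z φ₁ = z φ₂ ∧ p₁ = p₂) ∨ (z φ₂ = -z φ₁ ∧ p₂ = -p₁) :=
    fun φ₁ φ₂ p₁ h₁ p₂ h₂ => re_smul_im_smul_eq_iff (hnz φ₁)
      (mem_sphere_zero_iff_norm.mp h₁) (mem_sphere_zero_iff_norm.mp h₂)
  refine ⟨⟨fun hF => ?_, fun hγ => ?_⟩, fun _ φ₁ hφ₁ φ₂ hφ₂ p₁ hp₁ p₂ hp₂ hne => ?_⟩
  · rw [Set.eq_empty_iff_forall_notMem]
    rintro _ ⟨⟨φ₂, hφ₂, rfl⟩, _, ⟨φ₁, hφ₁, rfl⟩, hz⟩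
    have hp : EuclideanSpace.single (⟨0, by omega⟩ : Fin n) (1 : ℝ) ∈
        Metric.sphere (0 : EuclideanSpace ℝ (Fin n)) 1 := by simp
    have hp' : -EuclideanSpace.single (⟨0, by omega⟩ : Fin n) (1 : ℝ) ∈
        Metric.sphere (0 : EuclideanSpace ℝ (Fin n)) 1 := by simp
    have h := hF (Set.mk_mem_prod hφ₁ hp) (Set.mk_mem_prod hφ₂ hp')
      ((key φ₁ φ₂ _ hp _ hp').mpr (Or.inr ⟨hz.symm, rfl⟩))
    have hφ : φ₁ = φ₂ := congrArg Prod.fst h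
    subst hφ
    exact hnz φ₁ (neg_eq_self.mp hz)
  · rintro ⟨φ₁, p₁⟩ ⟨hφ₁, hp₁⟩ ⟨φ₂, p₂⟩ ⟨hφ₂, hp₂⟩ h
    rcases (key φ₁ φ₂ p₁ hp₁ p₂ hp₂).mp h with ⟨hz, hp⟩ | ⟨hz, -⟩
    · exact Prod.ext (hinj hφ₁ hφ₂ hz) hp
    · exact (Set.eq_empty_iff_forall_notMem.mp hγ (z φ₂)
        ⟨⟨φ₂, hφ₂, rfl⟩, z φ₁, ⟨φ₁, hφ₁, rfl⟩, hz.symm⟩).elim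
  · rw [key φ₁ φ₂ p₁ hp₁ p₂ hp₂, and_comm (a := p₂ = -p₁)]
    exact or_iff_right fun h => hne (Prod.ext (hinj hφ₁ hφ₂ h.1) h.2)
end

section
/- Let n ≥ 2 and let z : ℝ × [0,T) → ℂ \ {0} be a smooth solution of the equivariant flow (*), 2π-periodic and regular in φ for each t. If z(·,0) is injective on [0,2π) (the initial curve is embedded), then z(·,t) is injective on [0,2π) for every t ∈ [0,T). -/
open Real Set

open Filter Topology

lemma ip_self (w : ℂ) : ip w w = ‖w‖ ^ 2 := by
  rw [Complex.sq_norm, Complex.normSq_apply, ip]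

lemma ip_self_pos {w : ℂ} (hw : w ≠ 0) : 0 < ip w w := by
  rw [ip_self]; positivity

lemma ip_sub_right (w a b : ℂ) : ip w (a - b) = ip w a - ip w b := by
  simp only [ip, Complex.sub_re, Complex.sub_im]; ring

lemma ip_smul_right (w a : ℂ) (r : ℝ) : ip w (r • a) = r * ip w a := by
  simp only [ip, Complex.smul_re, Complex.smul_im, smul_eq_mul]; ring

lemma HasDerivAt.ip {v w : ℝ → ℂ} {v' w' : ℂ} {s : ℝ} (hv : HasDerivAt v v' s)
    (hw : HasDerivAt w w' s) :
    HasDerivAt (fun r => _root_.ip (v r) (w r)) (_root_.ip v' (w s) + _root_.ip (v s) w') s := by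
  have hvr := Complex.reCLM.hasFDerivAt.comp_hasDerivAt s hv
  have hvi := Complex.imCLM.hasFDerivAt.comp_hasDerivAt s hv
  have hwr := Complex.reCLM.hasFDerivAt.comp_hasDerivAt s hw
  have hwi := Complex.imCLM.hasFDerivAt.comp_hasDerivAt s hw
  refine ((hvr.mul hwr).add (hvi.mul hwi)).congr_deriv ?_
  simp [_root_.ip]
  ring

/-- Second-order necessary condition at a local minimum. -/
lemma IsLocalMin.second_deriv_nonneg {h h' : ℝ → ℝ} {s c : ℝ} (hmin : IsLocalMin h s)
    (hd : ∀ r, HasDerivAt h (h' r) r) (hd' : HasDerivAt h' c s) : 0 ≤ c := by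
  by_contra! hc
  have hh : deriv h = h' := funext fun r => (hd r).deriv
  have hmax : IsLocalMax h s :=
    isLocalMax_of_deriv_deriv_neg (by rwa [hh, hd'.deriv])
      (by rw [(hd s).deriv]; exact hmin.hasDerivAt_eq_zero (hd s)) (hd s).continuousAt
  have hconst : h =ᶠ[𝓝 s] fun _ => h s := by
    filter_upwards [hmin, hmax] with r h₁ h₂ using le_antisymm h₂ h₁
  have h0 : deriv (deriv h) s = 0 := by
    have := hconst.deriv.deriv_eq
    simpa using this
  rw [hh, hd'.deriv] at h0
  exact hc.ne h0

/-- A vector orthogonal to `w ≠ 0` is a multiple of the rotation of `w` by a right angle. -/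
lemma exists_eq_smul_rotation {w p : ℂ} (hw : w ≠ 0) (h : ip w p = 0) :
    ∃ α : ℝ, p = α • (⟨-w.im, w.re⟩ : ℂ) := by
  have hW := (ip_self_pos hw).ne'
  simp only [ip] at h hW
  rw [← pow_two, ← pow_two] at hW
  refine ⟨(w.re * p.im - w.im * p.re) / (w.re ^ 2 + w.im ^ 2), ?_⟩
  apply Complex.ext
  · simp only [Complex.smul_re, smul_eq_mul]
    field_simp
    linear_combination w.re * h
  · simp only [Complex.smul_im, smul_eq_mul]
    field_simp
    linear_combination w.im * h

/-- Component of the flow velocity in a direction `w` normal to the curve. -/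
lemma ip_velocity_of_tangent_orthogonal (n : ℕ) {γ : ℝ → ℂ} {x α : ℝ} {w : ℂ} (hw : w ≠ 0)
    (hα : α ≠ 0) (hT : deriv γ x = α • (⟨-w.im, w.re⟩ : ℂ)) :
    ip w (-(fq n γ x) • nu γ x) =
      ip w (deriv (deriv γ) x) / (α ^ 2 * ip w w)
        - ((n : ℝ) - 1) * (ip (γ x) w / ‖γ x‖ ^ 2) := by
  have hW := (ip_self_pos hw).ne'
  have hN2 : ‖deriv γ x‖ ^ 2 = α ^ 2 * ip w w := by
    rw [hT, Complex.sq_norm, Complex.normSq_apply]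
    simp only [ip, Complex.smul_re, Complex.smul_im, smul_eq_mul]
    ring
  have hN : ‖deriv γ x‖ ≠ 0 := by
    intro h0
    rw [h0] at hN2
    exact mul_ne_zero (pow_ne_zero 2 hα) hW (by rw [← hN2]; simp)
  have hnu : nu γ x = (‖deriv γ x‖⁻¹ * α) • w := by
    rw [nu, mul_smul]
    congr 1
    rw [hT]
    apply Complex.ext <;> simp
  have hcurv : curv γ x = -α * ip w (deriv (deriv γ) x) / ‖deriv γ x‖ ^ 3 := by
    rw [curv]
    congr 1
    rw [hT]
    simp only [ip, Complex.smul_re, Complex.smul_im, smul_eq_mul]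
    ring
  rw [fq, hcurv, hnu, ip_smul_right, ip_smul_right, ip_smul_right, ← hN2]
  have e1 : ∀ A B Q N W : ℝ, N ≠ 0 → N ^ 2 = α ^ 2 * W →
      -(-α * A / N ^ 3 + ((n : ℝ) - 1) * (N⁻¹ * α * B) / Q) * (N⁻¹ * α * W)
        = A / N ^ 2 - ((n : ℝ) - 1) * (B / Q) := by
    intro A B Q N W hN hW
    have h1 : α ^ 2 * W * (N⁻¹) ^ 2 = 1 := by rw [← hW]; field_simp
    calc _ = (α ^ 2 * W * (N⁻¹) ^ 2) * (A / N ^ 2 - ((n : ℝ) - 1) * (B / Q)) := by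
          simp only [div_eq_mul_inv, inv_pow]; field_simp; ring
      _ = _ := by rw [h1, one_mul]
  exact e1 _ _ _ _ _ hN hN2

/-- Lipschitz-type bound for the inversion `p ↦ p / ‖p‖²`. -/
lemma ip_inversion_sub_le {p q : ℂ} (hp : p ≠ 0) (hq : q ≠ 0) :
    ip p (p - q) / ‖p‖ ^ 2 - ip q (p - q) / ‖q‖ ^ 2 ≤ ip (p - q) (p - q) / (‖p‖ * ‖q‖) := by
  have hP : 0 < ‖p‖ := norm_pos_iff.2 hp
  have hQ : 0 < ‖q‖ := norm_pos_iff.2 hq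
  have hs : 0 ≤ ‖p‖ * ‖q‖ + ip p q := by
    have h1 : (ip p q) ^ 2 ≤ (‖p‖ * ‖q‖) ^ 2 := by
      rw [mul_pow, ← ip_self, ← ip_self]
      simp only [ip]
      nlinarith [sq_nonneg (p.re * q.im - p.im * q.re)]
    have := neg_le_of_abs_le (abs_le_of_sq_le_sq h1 (by positivity))
    linarith
  have e1 : ip p (p - q) = ‖p‖ ^ 2 - ip p q := by rw [ip_sub_right, ip_self]
  have e2 : ip q (p - q) = ip p q - ‖q‖ ^ 2 := by
    rw [ip_sub_right, ip_self]; simp only [ip]; ring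
  have e3 : ip (p - q) (p - q) = ‖p‖ ^ 2 + ‖q‖ ^ 2 - 2 * ip p q := by
    rw [← ip_self, ← ip_self]
    simp only [ip, Complex.sub_re, Complex.sub_im]
    ring
  rw [e1, e2, e3, ← sub_nonneg]
  have : (‖p‖ ^ 2 + ‖q‖ ^ 2 - 2 * ip p q) / (‖p‖ * ‖q‖)
      - ((‖p‖ ^ 2 - ip p q) / ‖p‖ ^ 2 - (ip p q - ‖q‖ ^ 2) / ‖q‖ ^ 2)
      = (‖p‖ * ‖q‖ + ip p q) * (‖p‖ - ‖q‖) ^ 2 / (‖p‖ ^ 2 * ‖q‖ ^ 2) := by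
    field_simp
    ring
  rw [this]
  positivity

/-- At a local spatial minimum of the distance between two points of a curve, the flow
decreases the squared distance at most exponentially. -/
lemma ip_velocity_sub_ge_of_isLocalMin (n : ℕ) (hn : 2 ≤ n) {γ : ℝ → ℂ}
    (hγ : ContDiff ℝ 2 γ) {x y : ℝ} (hx : deriv γ x ≠ 0) (hy : deriv γ y ≠ 0)
    (hx0 : γ x ≠ 0) (hy0 : γ y ≠ 0) (hw : γ x ≠ γ y)
    (hmin : IsLocalMin (fun p : ℝ × ℝ => ip (γ p.1 - γ p.2) (γ p.1 - γ p.2)) (x, y)) :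
    -((n : ℝ) - 1) * (ip (γ x - γ y) (γ x - γ y) / (‖γ x‖ * ‖γ y‖)) ≤
      ip (γ x - γ y) (-(fq n γ x) • nu γ x - -(fq n γ y) • nu γ y) := by
  have hd1 : ∀ r, HasDerivAt γ (deriv γ r) r := fun r =>
    (hγ.differentiable (by norm_num) r).hasDerivAt
  have hd2 : ∀ r, HasDerivAt (deriv γ) (deriv (deriv γ) r) r := fun r =>
    ((hγ.iterate_deriv' 1 1).differentiable (by norm_num) r).hasDerivAt
  have hline : ∀ (f : ℝ → ℂ) (f' : ℝ → ℂ), (∀ r, HasDerivAt f (f' r) r) → ∀ a x s : ℝ,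
      HasDerivAt (fun s => f (x + a * s)) (a • f' (x + a * s)) s := by
    intro f f' hf a x s
    have hl : HasDerivAt (fun s : ℝ => x + a * s) a s := by
      simpa using ((hasDerivAt_id s).const_mul a).const_add x
    exact (hf (x + a * s)).scomp s hl
  set w := γ x - γ y with hwdef
  have hw0 : w ≠ 0 := sub_ne_zero.2 hw
  have hlm : ∀ a b : ℝ, IsLocalMin (fun s : ℝ => ip (γ (x + a * s) - γ (y + b * s))
      (γ (x + a * s) - γ (y + b * s))) 0 := by
    intro a b
    have hc : Tendsto (fun s : ℝ => (x + a * s, y + b * s)) (𝓝 0) (𝓝 (x, y)) := by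
      have : Continuous (fun s : ℝ => (x + a * s, y + b * s)) := by fun_prop
      simpa using this.tendsto 0
    have := hc.eventually hmin
    simpa [IsLocalMin, IsMinFilter] using this
  have hW1 : ∀ a b s : ℝ, HasDerivAt (fun s : ℝ => γ (x + a * s) - γ (y + b * s))
      (a • deriv γ (x + a * s) - b • deriv γ (y + b * s)) s := fun a b s =>
    (hline _ _ hd1 a x s).sub (hline _ _ hd1 b y s)
  have hW2 : ∀ a b s : ℝ,
      HasDerivAt (fun s : ℝ => a • deriv γ (x + a * s) - b • deriv γ (y + b * s))
      (a • a • deriv (deriv γ) (x + a * s) - b • b • deriv (deriv γ) (y + b * s)) s :=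
    fun a b s => ((hline _ _ hd2 a x s).const_smul a).sub ((hline _ _ hd2 b y s).const_smul b)
  have hfirst : ∀ a b : ℝ, ip w (a • deriv γ x - b • deriv γ y) = 0 := by
    intro a b
    have := (hlm a b).hasDerivAt_eq_zero ((hW1 a b 0).ip (hW1 a b 0))
    simp only [mul_zero, add_zero, ← hwdef] at this
    simp only [ip] at this ⊢
    linarith
  have hsecond : ∀ a b : ℝ, a • deriv γ x = b • deriv γ y →
      0 ≤ a ^ 2 * ip w (deriv (deriv γ) x) - b ^ 2 * ip w (deriv (deriv γ) y) := by
    intro a b hab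
    have := (hlm a b).second_deriv_nonneg (fun r => (hW1 a b r).ip (hW1 a b r))
      (((hW2 a b 0).ip (hW1 a b 0)).add ((hW1 a b 0).ip (hW2 a b 0)))
    simp only [mul_zero, add_zero, ← hwdef, hab, sub_self] at this
    simp only [ip, Complex.zero_re, Complex.zero_im, Complex.sub_re, Complex.sub_im,
      Complex.smul_re, Complex.smul_im, smul_eq_mul] at this ⊢
    linarith
  obtain ⟨α, hα⟩ := exists_eq_smul_rotation hw0 (by simpa using hfirst 1 0)
  obtain ⟨β, hβ⟩ := exists_eq_smul_rotation (p := deriv γ y) hw0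
    (by simpa [ip] using hfirst 0 (-1))
  have hα0 : α ≠ 0 := by rintro rfl; exact hx (by simpa using hα)
  have hβ0 : β ≠ 0 := by rintro rfl; exact hy (by simpa using hβ)
  have h2 := hsecond α⁻¹ β⁻¹ (by
    rw [hα, hβ, smul_smul, smul_smul, inv_mul_cancel₀ hα0, inv_mul_cancel₀ hβ0])
  rw [ip_sub_right w (_ • nu γ x), ip_velocity_of_tangent_orthogonal n hw0 hα0 hα,
    ip_velocity_of_tangent_orthogonal n hw0 hβ0 hβ]
  have h3 := ip_inversion_sub_le hx0 hy0
  rw [← hwdef] at h3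
  have hn' : (0 : ℝ) ≤ (n : ℝ) - 1 := by
    have : (2 : ℝ) ≤ n := by exact_mod_cast hn
    linarith
  have h4 := mul_le_mul_of_nonneg_left h3 hn'
  have h5 : 0 ≤ ip w (deriv (deriv γ) x) / (α ^ 2 * ip w w)
      - ip w (deriv (deriv γ) y) / (β ^ 2 * ip w w) := by
    have := div_nonneg h2 (ip_self_pos hw0).le
    rw [sub_div] at this
    simpa only [div_eq_mul_inv, mul_inv, inv_pow, mul_comm, mul_left_comm, mul_assoc] using this
  linarith

/-- Uniform chord-arc estimate near the diagonal. -/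
lemma exists_chord_arc {z : ℝ → ℝ → ℂ} {L a : ℝ} (hL : 0 < L)
    (hc : Continuous fun p : ℝ × ℝ => deriv (z p.1) p.2) (hd : ∀ t, Differentiable ℝ (z t))
    (hper : ∀ t φ, z t (φ + L) = z t φ) (hreg : ∀ t ∈ Icc 0 a, ∀ φ, deriv (z t) φ ≠ 0) :
    ∃ δ > 0, ∃ c > 0, ∀ t ∈ Icc 0 a, ∀ x, ∀ h ∈ Icc 0 δ,
      c * h ≤ ‖z t (x + h) - z t x‖ := by
  have hK : IsCompact (Icc 0 a ×ˢ Icc 0 (L + 1) : Set (ℝ × ℝ)) := isCompact_Icc.prod isCompact_Icc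
  obtain ⟨m, hm, hmle⟩ := hK.exists_forall_le' (f := fun p : ℝ × ℝ => ‖deriv (z p.1) p.2‖)
    hc.norm.continuousOn (a := 0) (fun p hp => norm_pos_iff.2 (hreg _ hp.1 _))
  have huc := hK.uniformContinuousOn_of_continuous hc.continuousOn
  obtain ⟨δ, hδ, hδlt⟩ := Metric.uniformContinuousOn_iff.1 huc (m / 2) (by positivity)
  refine ⟨min (δ / 2) 1, by positivity, m / 2, by positivity, ?_⟩
  intro t ht x h hh
  have hp : Function.Periodic (fun x => ‖z t (x + h) - z t x‖) L := by
    intro x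
    dsimp only
    rw [show x + L + h = x + h + L by ring, hper, hper]
  obtain ⟨y, hy, hxy⟩ := hp.exists_mem_Ico₀ hL x
  rw [hxy]
  have hh1 : h ≤ 1 := hh.2.trans (min_le_right _ _)
  have hhδ : h ≤ δ / 2 := hh.2.trans (min_le_left _ _)
  have hyK : (t, y) ∈ (Icc 0 a ×ˢ Icc 0 (L + 1) : Set (ℝ × ℝ)) :=
    ⟨ht, hy.1, by linarith [hy.2]⟩
  have hbound : ∀ s ∈ Icc y (y + h), ‖deriv (z t) s - deriv (z t) y‖ ≤ m / 2 := by
    intro s hs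
    have hsK : (t, s) ∈ (Icc 0 a ×ˢ Icc 0 (L + 1) : Set (ℝ × ℝ)) :=
      ⟨ht, hy.1.trans hs.1, by linarith [hy.2, hs.2]⟩
    have := hδlt _ hsK _ hyK (by
      rw [Prod.dist_eq, dist_self, Real.dist_eq, abs_of_nonneg (by linarith [hs.1])]
      exact max_lt hδ (by linarith [hs.2]))
    rw [dist_eq_norm] at this
    exact this.le
  have hmv := (convex_Icc y (y + h)).norm_image_sub_le_of_norm_hasDerivWithin_le
    (f := fun s => z t s - s • deriv (z t) y) (f' := fun s => deriv (z t) s - deriv (z t) y)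
    (fun s _ => (((hd t s).hasDerivAt).sub
      (by simpa using (hasDerivAt_id s).smul_const (deriv (z t) y))).hasDerivWithinAt)
    hbound (left_mem_Icc.2 (by linarith [hh.1])) (right_mem_Icc.2 (by linarith [hh.1]))
  have e : z t (y + h) - (y + h) • deriv (z t) y - (z t y - y • deriv (z t) y)
      = z t (y + h) - z t y - h • deriv (z t) y := by rw [add_smul]; abel
  rw [e, add_sub_cancel_left, Real.norm_of_nonneg hh.1] at hmv
  have h1 : ‖h • deriv (z t) y‖ ≤ ‖z t (y + h) - z t y‖
      + ‖z t (y + h) - z t y - h • deriv (z t) y‖ := by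
    rw [norm_sub_rev (z t (y + h) - z t y)]
    have := norm_add_le (z t (y + h) - z t y) (h • deriv (z t) y - (z t (y + h) - z t y))
    simpa using this
  rw [norm_smul, Real.norm_of_nonneg hh.1] at h1
  have h2 := mul_le_mul_of_nonneg_left (hmle _ hyK) hh.1
  dsimp only at h2
  linarith

/-- An embedded closed curve separates any two distinct parameters within one period. -/
lemma ne_of_injOn_Ico {γ : ℝ → ℂ} {L : ℝ} (hL : 0 < L) (hper : ∀ φ, γ (φ + L) = γ φ)
    (hinj : InjOn γ (Ico 0 L)) {x h : ℝ} (h0 : 0 < h) (hhL : h < L) : γ (x + h) ≠ γ x := by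
  have hp : Function.Periodic (fun x => γ (x + h) - γ x) L := by
    intro x
    dsimp only
    rw [show x + L + h = x + h + L by ring, hper, hper]
  obtain ⟨y, hy, hxy⟩ := hp.exists_mem_Ico₀ hL x
  rw [← sub_ne_zero, hxy, sub_ne_zero]
  intro he
  rcases lt_or_ge (y + h) L with hl | hl
  · have := hinj ⟨by linarith [hy.1], hl⟩ hy he
    linarith
  · have he' : γ (y + h - L) = γ y := by rw [← he, ← hper (y + h - L)]; congr 1; ring
    have := hinj ⟨by linarith, by linarith [hy.2]⟩ hy he'
    linarith

/-- The equivariant flow ∂_t z = −f ν preserves embeddedness of the profile curve. -/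
theorem flow_preserves_embeddedness (n : ℕ) (hn : 2 ≤ n) (T : ℝ) (z : ℝ → ℝ → ℂ)
    (hsm : ContDiff ℝ (⊤ : ℕ∞) (fun p : ℝ × ℝ => z p.1 p.2))
    (hper : ∀ t φ, z t (φ + 2 * π) = z t φ)
    (hreg : ∀ t ∈ Ico (0:ℝ) T, ∀ φ, deriv (z t) φ ≠ 0)
    (hnz : ∀ t ∈ Ico (0:ℝ) T, ∀ φ, z t φ ≠ 0)
    (hflow : ∀ t ∈ Ico (0:ℝ) T, ∀ φ,
      deriv (fun s => z s φ) t = -(fq n (z t) φ) • nu (z t) φ)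
    (hemb : InjOn (z 0) (Ico 0 (2 * π))) :
    ∀ t ∈ Ico (0:ℝ) T, InjOn (z t) (Ico 0 (2 * π)) := by
  intro t₁ ht₁
  have hL : (0 : ℝ) < 2 * π := by positivity
  have hIcc : ∀ t ∈ Icc 0 t₁, t ∈ Ico 0 T := fun t ht => ⟨ht.1, ht.2.trans_lt ht₁.2⟩
  have hzc : Continuous fun p : ℝ × ℝ => z p.1 p.2 := hsm.continuous
  have hγ : ∀ t, ContDiff ℝ (⊤ : ℕ∞) (z t) := fun t =>
    hsm.comp (contDiff_const.prodMk contDiff_id)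
  have hdφ : ∀ t, Differentiable ℝ (z t) := fun t => (hγ t).differentiable (by simp)
  have hdt : ∀ t φ, HasDerivAt (fun s => z s φ) (deriv (fun s => z s φ) t) t := fun t φ =>
    ((hsm.comp (contDiff_id.prodMk contDiff_const)).differentiable (by simp) t).hasDerivAt
  have hPc : Continuous fun p : ℝ × ℝ => deriv (z p.1) p.2 := by
    have he : (fun p : ℝ × ℝ => deriv (z p.1) p.2)
        = fun p => fderiv ℝ (fun p : ℝ × ℝ => z p.1 p.2) p (0, 1) := by
      funext p
      have h1 := (hsm.differentiable (by simp) p).hasFDerivAt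
      have h2 : HasDerivAt (fun s : ℝ => (p.1, s)) ((0 : ℝ), (1 : ℝ)) p.2 :=
        (hasDerivAt_const _ _).prodMk (hasDerivAt_id _)
      exact (h1.comp_hasDerivAt p.2 h2).deriv
    rw [he]
    exact (hsm.continuous_fderiv (by simp)).clm_apply continuous_const
  obtain ⟨δ, hδ, c, hc, hca⟩ := exists_chord_arc hL hPc hdφ hper fun t ht => hreg t (hIcc t ht)
  obtain ⟨m, hm, hmle⟩ : ∃ m > 0, ∀ t ∈ Icc 0 t₁, ∀ φ, m ≤ ‖z t φ‖ := by
    obtain ⟨m, hm, hmle⟩ := (isCompact_Icc.prod isCompact_Icc :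
      IsCompact (Icc 0 t₁ ×ˢ Icc 0 (2 * π))).exists_forall_le' (a := 0) hzc.norm.continuousOn
        (fun p hp => norm_pos_iff.2 (hnz _ (hIcc _ hp.1) _))
    refine ⟨m, hm, fun t ht φ => ?_⟩
    obtain ⟨y, hy, hxy⟩ := Function.Periodic.exists_mem_Ico₀ (hper t) hL φ
    rw [hxy]
    exact hmle (t, y) ⟨ht, Ico_subset_Icc_self hy⟩
  have hn' : (0 : ℝ) ≤ (n : ℝ) - 1 := by
    have : (2 : ℝ) ≤ n := by exact_mod_cast hn
    linarith
  let K : ℝ := 2 * ((n : ℝ) - 1) / m ^ 2 + 1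
  have hK : 0 < K := by positivity
  let D : ℝ → ℝ → ℝ → ℝ := fun t x h => ip (z t (x + h) - z t x) (z t (x + h) - z t x)
  let F : ℝ → ℝ → ℝ → ℝ := fun t x h => exp (K * t) * D t x h
  have hDc : Continuous fun p : ℝ × ℝ × ℝ => D p.1 p.2.1 p.2.2 := by
    have : Continuous fun p : ℝ × ℝ × ℝ => z p.1 (p.2.1 + p.2.2) - z p.1 p.2.1 :=
      (hzc.comp (f := fun p : ℝ × ℝ × ℝ => (p.1, p.2.1 + p.2.2)) (by fun_prop)).sub
        (hzc.comp (f := fun p : ℝ × ℝ × ℝ => (p.1, p.2.1)) (by fun_prop))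
    simp only [D, ip_self]
    exact this.norm.pow 2
  have hFc : Continuous fun p : ℝ × ℝ × ℝ => F p.1 p.2.1 p.2.2 := by
    refine Continuous.mul ?_ hDc
    fun_prop
  have hFper : ∀ t h x, F t (x + 2 * π) h = F t x h := by
    intro t h x
    simp only [F, D]
    rw [show x + 2 * π + h = x + h + 2 * π by ring, hper, hper]
  have hDsymm : ∀ t x h, D t (x + h) (2 * π - h) = D t x h := by
    intro t x h
    simp only [D]
    rw [show x + h + (2 * π - h) = x + 2 * π by ring, hper, ip_self, ip_self, norm_sub_rev]
  have hDchord : ∀ t ∈ Icc 0 t₁, ∀ x, ∀ h ∈ Icc 0 δ, (c * h) ^ 2 ≤ D t x h := by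
    intro t ht x h hh
    simp only [D, ip_self]
    exact pow_le_pow_left₀ (mul_nonneg hc.le hh.1) (hca t ht x h hh) 2
  have hDF : ∀ t ∈ Icc 0 t₁, ∀ x h, D t x h ≤ F t x h := by
    intro t ht x h
    have h0 : 0 ≤ D t x h := by simp only [D, ip_self]; positivity
    exact le_mul_of_one_le_left h0 (one_le_exp (mul_nonneg hK.le ht.1))
  obtain ⟨m₁, hm₁, hm₁le⟩ := (isCompact_Icc.prod isCompact_Icc :
      IsCompact (Icc 0 (2 * π) ×ˢ Icc δ (2 * π - δ))).exists_forall_le' (a := 0)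
      (f := fun p : ℝ × ℝ => F 0 p.1 p.2)
      (hFc.comp (f := fun p : ℝ × ℝ => ((0 : ℝ), p.1, p.2)) (by fun_prop)).continuousOn (by
        intro p hp
        have h2 := hp.2
        have := ne_of_injOn_Ico (x := p.1) (h := p.2) hL (hper 0) hemb
          (by linarith [h2.1]) (by linarith [h2.2])
        exact mul_pos (exp_pos _) (ip_self_pos (sub_ne_zero.2 this)))
  obtain ⟨ε, hε, hε1, hε2⟩ : ∃ ε > 0, ε < m₁ ∧ ε < (c * δ) ^ 2 := by
    obtain ⟨ε, h1, h2⟩ := exists_between (lt_min hm₁ (by positivity : 0 < (c * δ) ^ 2))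
    exact ⟨ε, h1, h2.trans_le (min_le_left _ _), h2.trans_le (min_le_right _ _)⟩
  have key : ∀ t ∈ Icc 0 t₁, ∀ x ∈ Icc 0 (2 * π), ∀ h ∈ Icc δ (2 * π - δ), ε < F t x h := by
    by_contra! hcon
    obtain ⟨t', ht', x', hx', h', hh', hF'⟩ := hcon
    let B : Set (ℝ × ℝ × ℝ) := (Icc 0 t₁ ×ˢ Icc 0 (2 * π) ×ˢ Icc δ (2 * π - δ)) ∩
      {p | F p.1 p.2.1 p.2.2 ≤ ε}
    have hB : IsCompact B := (isCompact_Icc.prod (isCompact_Icc.prod isCompact_Icc)).inter_right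
      (isClosed_le hFc continuous_const)
    obtain ⟨⟨t, x, h⟩, ⟨⟨ht, hx, hh⟩, hFε⟩, hmin⟩ :=
      hB.exists_isMinOn ⟨(t', x', h'), ⟨ht', hx', hh'⟩, hF'⟩ continuous_fst.continuousOn
    dsimp only at ht hx hh
    change F t x h ≤ ε at hFε
    have ht0 : 0 < t := by
      refine ht.1.lt_of_ne ?_
      rintro rfl
      have := hm₁le (x, h) ⟨hx, hh⟩
      dsimp only at this
      linarith
    have hhδ : δ < h := by
      refine hh.1.lt_of_ne ?_
      rintro rfl
      have := hDchord t ht x δ ⟨hδ.le, le_rfl⟩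
      linarith [hDF t ht x δ]
    have hhδ' : h < 2 * π - δ := by
      refine hh.2.lt_of_ne fun he => ?_
      have := hDchord t ht (x + h) δ ⟨hδ.le, le_rfl⟩
      rw [show δ = 2 * π - h by linarith, hDsymm, ← show δ = 2 * π - h by linarith] at this
      linarith [hDF t ht x h]
    have hbefore : ∀ s ∈ Ico 0 t, ∀ y, ∀ k ∈ Icc δ (2 * π - δ), ε < F s y k := by
      intro s hs y k hk
      obtain ⟨y', hy', hyy⟩ := Function.Periodic.exists_mem_Ico₀
        (f := fun y => F s y k) (hFper s k) hL y
      refine lt_of_lt_of_eq ?_ hyy.symm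
      by_contra! hle
      have := hmin (a := (s, y', k))
        ⟨⟨⟨hs.1, hs.2.le.trans ht.2⟩, Ico_subset_Icc_self hy', hk⟩, hle⟩
      exact absurd hs.2 (not_lt.2 this)
    have hev : ∀ᶠ s in 𝓝[<] t, s ∈ Ico 0 t := by
      filter_upwards [Ioo_mem_nhdsLT ht0] with s hs using ⟨hs.1.le, hs.2⟩
    have hat : ∀ y, ∀ k ∈ Icc δ (2 * π - δ), ε ≤ F t y k := by
      intro y k hk
      have hcont : Continuous fun s => F s y k :=
        hFc.comp (f := fun s : ℝ => (s, y, k)) (by fun_prop)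
      refine ge_of_tendsto (x := 𝓝[<] t) ((hcont.tendsto t).mono_left nhdsWithin_le_nhds) ?_
      filter_upwards [hev] with s hs using (hbefore s hs y k hk).le
    have hne : z t (x + h) ≠ z t x := by
      intro he
      have h1 := hat x h hh
      simp [F, D, he, ip] at h1
      linarith
    have hlmin : IsLocalMin (fun p : ℝ × ℝ => ip (z t p.1 - z t p.2) (z t p.1 - z t p.2))
        (x + h, x) := by
      have hcont : Continuous fun p : ℝ × ℝ => p.1 - p.2 := by fun_prop
      have := hcont.tendsto (x + h, x)
      simp only [add_sub_cancel_left] at this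
      filter_upwards [this.eventually (Icc_mem_nhds hhδ hhδ')] with p hp
      have h1 := hFε.trans (hat p.2 (p.1 - p.2) hp)
      have h2 := le_of_mul_le_mul_left h1 (exp_pos _)
      simpa only [D, add_sub_cancel] using h2
    have htT := hIcc t ht
    have hvel := ip_velocity_sub_ge_of_isLocalMin n hn
      (contDiff_infty.1 (hγ t) 2) (hreg t htT _) (hreg t htT _) (hnz t htT _)
      (hnz t htT _) hne hlmin
    rw [← hflow t htT, ← hflow t htT] at hvel
    set w' := deriv (fun s => z s (x + h)) t - deriv (fun s => z s x) t with hw'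
    have hw : HasDerivAt (fun s => z s (x + h) - z s x) w' t := (hdt t _).sub (hdt t _)
    have hG : HasDerivAt (fun s => F s x h)
        (exp (K * t) * K * D t x h + exp (K * t) *
          (ip w' (z t (x + h) - z t x) + ip (z t (x + h) - z t x) w')) t := by
      have hE : HasDerivAt (fun s => exp (K * s)) (exp (K * t) * K) t := by
        simpa using ((hasDerivAt_id t).const_mul K).exp
      exact hE.mul (hw.ip hw)
    have hGle : exp (K * t) * K * D t x h + exp (K * t) *
          (ip w' (z t (x + h) - z t x) + ip (z t (x + h) - z t x) w') ≤ 0 := by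
      have hsl := (hasDerivAt_iff_tendsto_slope.1 hG).mono_left
        (nhdsLT_le_nhdsNE t)
      refine le_of_tendsto hsl ?_
      filter_upwards [hev] with s hs
      rw [slope_def_field]
      exact div_nonpos_of_nonneg_of_nonpos
        (sub_nonneg.2 (hFε.trans (hbefore s hs x h hh).le)) (sub_nonpos.2 hs.2.le)
    have hDpos : 0 < D t x h := ip_self_pos (sub_ne_zero.2 hne)
    have hcomm : ip w' (z t (x + h) - z t x) = ip (z t (x + h) - z t x) w' := by
      simp only [ip]; ring
    have hbd : D t x h / (‖z t (x + h)‖ * ‖z t x‖) ≤ D t x h / m ^ 2 := by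
      refine div_le_div_of_nonneg_left hDpos.le (by positivity) ?_
      rw [pow_two]
      exact mul_le_mul (hmle t ht _) (hmle t ht _) hm.le (norm_nonneg _)
    have hbd' := mul_le_mul_of_nonneg_left hbd hn'
    have hKD : K * D t x h = 2 * (((n : ℝ) - 1) * (D t x h / m ^ 2)) + D t x h := by
      simp only [K]; ring
    have hpos : 0 < K * D t x h + 2 * ip (z t (x + h) - z t x) w' := by
      change -((n : ℝ) - 1) * (D t x h / (‖z t (x + h)‖ * ‖z t x‖)) ≤ _ at hvel
      linarith
    have := mul_pos (exp_pos (K * t)) hpos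
    rw [hcomm] at hGle
    linarith
  have hDpos : ∀ x ∈ Ico 0 (2 * π), ∀ y ∈ Ico 0 (2 * π), x < y → z t₁ x ≠ z t₁ y := by
    intro x hx y hy hxy he
    have ht : t₁ ∈ Icc 0 t₁ := ⟨ht₁.1, le_rfl⟩
    have hD0 : D t₁ x (y - x) = 0 := by simp [D, he, ip]
    rcases le_or_gt (y - x) δ with h1 | h1
    · have := hDchord t₁ ht x (y - x) ⟨by linarith, h1⟩
      have : 0 < (c * (y - x)) ^ 2 := by have := sub_pos.2 hxy; positivity
      linarith
    rcases le_or_gt (2 * π - (y - x)) δ with h2 | h2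
    · have h3 : 0 < 2 * π - (y - x) := by linarith [hx.1, hy.2]
      have := hDchord t₁ ht (x + (y - x)) (2 * π - (y - x)) ⟨h3.le, h2⟩
      rw [hDsymm] at this
      have : 0 < (c * (2 * π - (y - x))) ^ 2 := by positivity
      linarith
    · have := key t₁ ht x (Ico_subset_Icc_self hx) (y - x) ⟨h1.le, by linarith⟩
      simp only [F, hD0, mul_zero] at this
      linarith
  intro x hx y hy he
  rcases lt_trichotomy x y with h | h | h
  · exact absurd he (hDpos x hx y hy h)
  · exact h
  · exact absurd he.symm (hDpos y hy x hx h)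
end

section
/- Let n ≥ 2 and let z : ℝ × [0,T) → ℂ \ {0} be a smooth solution of the equivariant flow (*), 2π-periodic and regular in φ for each t. Then the total integral I(t) := ∫₀^{2π} (f √g)(φ,t) dφ is independent of t, and the symplectic area evolves linearly: A(z(·,t)) = A(z(·,0)) − t · I(0) for all t ∈ [0,T). -/
open Real Set

/-- The map `p ↦ D w(p) v` has derivative `u ↦ D²w(p) u v`. -/
theorem hasFDerivAt_fderiv_apply_const {w : ℝ × ℝ → ℂ} (hw : ContDiff ℝ 2 w) (v p : ℝ × ℝ) :
    HasFDerivAt (fun q => fderiv ℝ w q v) ((fderiv ℝ (fderiv ℝ w) p).flip v) p := by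
  have h1 : ContDiff ℝ 1 (fderiv ℝ w) := hw.fderiv_right (by norm_num)
  have h2 := (h1.differentiable (by norm_num) p).hasFDerivAt.clm_apply (hasFDerivAt_const v p)
  rwa [ContinuousLinearMap.comp_zero, zero_add] at h2

/-- Green's formula for the form `m dw` on a cylinder `[0, t] × ℝ/Lℤ`. -/
theorem integral_green_cylinder {w m : ℝ × ℝ → ℂ} {t L : ℝ} (ht : 0 ≤ t)
    (hw : ContDiff ℝ 2 w) (hm : ∀ p : ℝ × ℝ, p.1 ∈ Icc 0 t → ContDiffAt ℝ 1 m p)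
    (hwp : ∀ p, w (p + (0, L)) = w p) (hmp : ∀ p, m (p + (0, L)) = m p) :
    (∫ s in (0:ℝ)..t, ∫ φ in (0:ℝ)..L,
      (fderiv ℝ m (s, φ) (1, 0) * fderiv ℝ w (s, φ) (0, 1) -
        fderiv ℝ m (s, φ) (0, 1) * fderiv ℝ w (s, φ) (1, 0))) =
      (∫ φ in (0:ℝ)..L, m (t, φ) * fderiv ℝ w (t, φ) (0, 1)) -
        ∫ φ in (0:ℝ)..L, m (0, φ) * fderiv ℝ w (0, φ) (0, 1) := by
  have hdw : ContDiff ℝ 1 (fderiv ℝ w) := hw.fderiv_right (by norm_num)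
  have hcw (v : ℝ × ℝ) : Continuous fun p => fderiv ℝ w p v := by
    have := hdw.continuous
    fun_prop
  have hmem {p : ℝ × ℝ} (hp : p ∈ uIcc 0 t ×ˢ uIcc 0 L) : p.1 ∈ Icc 0 t := by
    simpa [uIcc_of_le ht] using hp.1
  have hmem' {p : ℝ × ℝ} (hp : p ∈ Ioo (min 0 t) (max 0 t) ×ˢ Ioo (min 0 L) (max 0 L)) :
      p.1 ∈ Icc 0 t := by
    have := hp.1
    rw [min_eq_left ht, max_eq_right ht] at this
    exact Ioo_subset_Icc_self this
  have hdm {p : ℝ × ℝ} (hp : p.1 ∈ Icc 0 t) : HasFDerivAt m (fderiv ℝ m p) p :=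
    ((hm p hp).differentiableAt (by norm_num)).hasFDerivAt
  have hcm (v : ℝ × ℝ) {p : ℝ × ℝ} (hp : p.1 ∈ Icc 0 t) :
      ContinuousAt (fun q => fderiv ℝ m q v) p :=
    (((hm p hp).fderiv_right (m := 0) (by norm_num)).continuousAt).clm_apply continuousAt_const
  have hsym (p : ℝ × ℝ) := (hw.contDiffAt (x := p)).isSymmSndFDerivAt (by simp)
  have hper : ∀ p, fderiv ℝ w (p + (0, L)) = fderiv ℝ w p := fun p => by
    rw [← fderiv_comp_add_right]
    simp_rw [hwp]
  have key := MeasureTheory.integral2_divergence_prod_of_hasFDerivAt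
    (fun p => m p * fderiv ℝ w p (0, 1)) (fun p => -(m p * fderiv ℝ w p (1, 0)))
    (fun p => m p • (fderiv ℝ (fderiv ℝ w) p).flip (0, 1) + (fderiv ℝ w p (0, 1)) • fderiv ℝ m p)
    (fun p => -(m p • (fderiv ℝ (fderiv ℝ w) p).flip (1, 0) +
      (fderiv ℝ w p (1, 0)) • fderiv ℝ m p))
    0 0 t L
    (fun p hp => ((hm p (hmem hp)).continuousAt.mul (hcw _).continuousAt).continuousWithinAt)
    (fun p hp => ((hm p (hmem hp)).continuousAt.mul (hcw _).continuousAt).neg.continuousWithinAt)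
    (fun p hp => (hdm (hmem' hp)).mul (hasFDerivAt_fderiv_apply_const hw _ p))
    (fun p hp => ((hdm (hmem' hp)).mul (hasFDerivAt_fderiv_apply_const hw _ p)).neg)
  have hdiv (p : ℝ × ℝ) :
      (m p • (fderiv ℝ (fderiv ℝ w) p).flip (0, 1) + (fderiv ℝ w p (0, 1)) • fderiv ℝ m p) (1, 0) +
        (-(m p • (fderiv ℝ (fderiv ℝ w) p).flip (1, 0) +
          (fderiv ℝ w p (1, 0)) • fderiv ℝ m p)) (0, 1) =
      fderiv ℝ m p (1, 0) * fderiv ℝ w p (0, 1) - fderiv ℝ m p (0, 1) * fderiv ℝ w p (1, 0) := by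
    have := hsym p (1, 0) (0, 1)
    simp only [add_apply, neg_apply, smul_apply, ContinuousLinearMap.flip_apply, smul_eq_mul, this]
    ring
  simp only [hdiv] at key
  rw [key]
  · have hmL (s : ℝ) : m (s, L) = m (s, 0) := by simpa using hmp (s, 0)
    have hwL (s : ℝ) : fderiv ℝ w (s, L) = fderiv ℝ w (s, 0) := by simpa using hper (s, 0)
    simp [hmL, hwL]
  · refine ContinuousOn.integrableOn_compact (isCompact_uIcc.prod isCompact_uIcc) fun p hp => ?_
    exact (((hcm _ (hmem hp)).mul (hcw _).continuousAt).sub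
      ((hcm _ (hmem hp)).mul (hcw _).continuousAt)).continuousWithinAt

/-- The integral of the logarithmic derivative of a nonvanishing loop is a homotopy invariant. -/
theorem integral_logDeriv_eq {w : ℝ × ℝ → ℂ} {t L : ℝ} (ht : 0 ≤ t)
    (hw : ContDiff ℝ 2 w) (hw0 : ∀ p : ℝ × ℝ, p.1 ∈ Icc 0 t → w p ≠ 0)
    (hwp : ∀ p, w (p + (0, L)) = w p) :
    (∫ φ in (0:ℝ)..L, (w (t, φ))⁻¹ * fderiv ℝ w (t, φ) (0, 1)) =
      ∫ φ in (0:ℝ)..L, (w (0, φ))⁻¹ * fderiv ℝ w (0, φ) (0, 1) := by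
  have key := integral_green_cylinder (m := fun p => (w p)⁻¹) ht hw
    (fun p hp => (hw.contDiffAt.of_le (by norm_num)).inv (hw0 p hp)) hwp (fun p => by rw [hwp])
  rw [← sub_eq_zero, ← key]
  refine intervalIntegral.integral_zero_ae (Filter.Eventually.of_forall fun s hs => ?_)
  rw [uIoc_of_le ht] at hs
  refine intervalIntegral.integral_zero_ae (Filter.Eventually.of_forall fun φ _ => ?_)
  have hinv : fderiv ℝ (fun p => (w p)⁻¹) (s, φ) = -(w (s, φ) ^ 2)⁻¹ • fderiv ℝ w (s, φ) := by
    have h1 := (hw.differentiable (by norm_num) (s, φ)).hasFDerivAt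
    have h2 := (hasDerivAt_inv (hw0 (s, φ) (Ioc_subset_Icc_self hs))).comp_hasFDerivAt_of_eq _ h1 rfl
    exact h2.fderiv
  simp only [hinv, smul_apply, smul_eq_mul]
  ring

theorem fq_mul_norm_deriv (n : ℕ) (c : ℝ → ℂ) (φ : ℝ) (hc : deriv c φ ≠ 0) :
    fq n c φ * ‖deriv c φ‖ =
      ((deriv c φ)⁻¹ * deriv (deriv c) φ + ((n : ℂ) - 1) * ((c φ)⁻¹ * deriv c φ)).im := by
  have hN : ‖deriv c φ‖ ≠ 0 := norm_ne_zero_iff.2 hc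
  have hn : ((n : ℂ) - 1) = (((n : ℝ) - 1 : ℝ) : ℂ) := by push_cast; rfl
  rw [hn, Complex.add_im, Complex.im_ofReal_mul]
  simp only [Complex.mul_im, Complex.inv_re, Complex.inv_im, Complex.normSq_eq_norm_sq, fq, curv,
    ip, nu, Complex.smul_re, Complex.smul_im, smul_eq_mul]
  by_cases hz : c φ = 0
  · simp only [hz]
    simp
    field_simp
    ring
  · have hM : ‖c φ‖ ≠ 0 := norm_ne_zero_iff.2 hz
    field_simp
    ring

/-- For n ≥ 2, the total integral I(t) = ∫₀^{2π} f√g dφ is constant in time and the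
symplectic area evolves linearly: A(z(·,t)) = A(z(·,0)) − t·I(0). -/
theorem symplectic_area_formula (n : ℕ) (hn : 2 ≤ n) (T : ℝ) (z : ℝ → ℝ → ℂ)
    (hsm : ContDiff ℝ (⊤ : ℕ∞) (fun p : ℝ × ℝ => z p.1 p.2))
    (hper : ∀ t φ, z t (φ + 2 * π) = z t φ)
    (hreg : ∀ t ∈ Ico (0:ℝ) T, ∀ φ, deriv (z t) φ ≠ 0)
    (hnz : ∀ t ∈ Ico (0:ℝ) T, ∀ φ, z t φ ≠ 0)
    (hflow : ∀ t ∈ Ico (0:ℝ) T, ∀ φ,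
      deriv (fun s => z s φ) t = -(fq n (z t) φ) • nu (z t) φ) :
    ∀ t ∈ Ico (0:ℝ) T,
      (∫ φ in (0:ℝ)..(2 * π), fq n (z t) φ * ‖deriv (z t) φ‖) =
        (∫ φ in (0:ℝ)..(2 * π), fq n (z 0) φ * ‖deriv (z 0) φ‖) ∧
      (1 / 2) * (∫ φ in (0:ℝ)..(2 * π), ((starRingEnd ℂ) (z t φ) * deriv (z t) φ).im) =
        (1 / 2) * (∫ φ in (0:ℝ)..(2 * π), ((starRingEnd ℂ) (z 0 φ) * deriv (z 0) φ).im) -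
          t * ∫ φ in (0:ℝ)..(2 * π), fq n (z 0) φ * ‖deriv (z 0) φ‖ := by
  intro t ht
  set Z : ℝ × ℝ → ℂ := fun p => z p.1 p.2 with hZ
  have hZ2 : ContDiff ℝ 2 Z := hsm.of_le (WithTop.coe_le_coe.2 le_top)
  set W : ℝ × ℝ → ℂ := fun p => fderiv ℝ Z p (0, 1) with hW
  have hW2 : ContDiff ℝ 2 W :=
    (hsm.fderiv_right (m := 2) (WithTop.coe_le_coe.2 le_top)).clm_apply contDiff_const
  have hsec (F : ℝ × ℝ → ℂ) (hF : ContDiff ℝ 2 F) (s φ : ℝ) :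
      HasDerivAt (fun ψ => F (s, ψ)) (fderiv ℝ F (s, φ) (0, 1)) φ :=
    (hF.differentiable (by norm_num) (s, φ)).hasFDerivAt.comp_hasDerivAt φ
      ((hasDerivAt_const φ s).prodMk (hasDerivAt_id φ))
  have hcont (F : ℝ × ℝ → ℂ) (hF : ContDiff ℝ 2 F) (v : ℝ × ℝ) :
      Continuous fun p => fderiv ℝ F p v :=
    (hF.continuous_fderiv (by norm_num)).clm_apply continuous_const
  have hzφ (s : ℝ) : deriv (z s) = fun φ => W (s, φ) := funext fun φ => (hsec Z hZ2 s φ).deriv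
  have hzφφ (s φ : ℝ) : deriv (deriv (z s)) φ = fderiv ℝ W (s, φ) (0, 1) := by
    rw [hzφ]
    exact (hsec W hW2 s φ).deriv
  have hzt (s φ : ℝ) : deriv (fun s => z s φ) s = fderiv ℝ Z (s, φ) (1, 0) :=
    ((hZ2.differentiable (by norm_num) (s, φ)).hasFDerivAt.comp_hasDerivAt (f := fun r => (r, φ)) s
      ((hasDerivAt_id s).prodMk (hasDerivAt_const s φ))).deriv
  have hZp (p : ℝ × ℝ) : Z (p + (0, 2 * π)) = Z p := by simp [hZ, hper]
  have hWp (p : ℝ × ℝ) : W (p + (0, 2 * π)) = W p := by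
    simp only [hW]
    rw [← fderiv_comp_add_right]
    simp_rw [hZp]
  have hW0 (s : ℝ) (hs : s ∈ Ico 0 T) (φ : ℝ) : W (s, φ) ≠ 0 := by
    have := hreg s hs φ
    rwa [hzφ] at this
  have hIeq (s : ℝ) (hs : s ∈ Ico 0 T) :
      (∫ φ in (0:ℝ)..(2 * π), fq n (z s) φ * ‖deriv (z s) φ‖) =
        ((∫ φ in (0:ℝ)..(2 * π), (W (s, φ))⁻¹ * fderiv ℝ W (s, φ) (0, 1)) +
          ((n : ℂ) - 1) * ∫ φ in (0:ℝ)..(2 * π), (Z (s, φ))⁻¹ * fderiv ℝ Z (s, φ) (0, 1)).im := by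
    have h1 : Continuous fun φ => (W (s, φ))⁻¹ * fderiv ℝ W (s, φ) (0, 1) :=
      ((hW2.continuous.comp (by fun_prop)).inv₀ (hW0 s hs)).mul
        ((hcont W hW2 _).comp (by fun_prop))
    have h2 : Continuous fun φ => (Z (s, φ))⁻¹ * fderiv ℝ Z (s, φ) (0, 1) :=
      ((hZ2.continuous.comp (by fun_prop)).inv₀ (hnz s hs)).mul
        ((hcont Z hZ2 _).comp (by fun_prop))
    have h3 : Continuous fun φ =>
        ((n : ℂ) - 1) * ((Z (s, φ))⁻¹ * fderiv ℝ Z (s, φ) (0, 1)) := continuous_const.mul h2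
    rw [← intervalIntegral.integral_const_mul, ← intervalIntegral.integral_add
      (h1.intervalIntegrable _ _) (h3.intervalIntegrable _ _)]
    refine Eq.trans ?_ (intervalIntegral.intervalIntegral_im
      ((h1.add h3).intervalIntegrable _ _))
    refine intervalIntegral.integral_congr fun φ _ => ?_
    simp only [fq_mul_norm_deriv n (z s) φ (hreg s hs φ), hzφφ]
    simp only [hzφ]
    rfl
  have hIconst (s : ℝ) (hs : s ∈ Ico 0 T) :
      (∫ φ in (0:ℝ)..(2 * π), fq n (z s) φ * ‖deriv (z s) φ‖) =
        ∫ φ in (0:ℝ)..(2 * π), fq n (z 0) φ * ‖deriv (z 0) φ‖ := by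
    rw [hIeq s hs, hIeq 0 ⟨le_rfl, hs.1.trans_lt hs.2⟩,
      integral_logDeriv_eq hs.1 hW2
        (fun p hp => hW0 p.1 ⟨hp.1, hp.2.trans_lt hs.2⟩ p.2) hWp,
      integral_logDeriv_eq hs.1 hZ2
        (fun p hp => hnz p.1 ⟨hp.1, hp.2.trans_lt hs.2⟩ p.2) hZp]
  refine ⟨hIconst t ht, ?_⟩
  have green := integral_green_cylinder (m := fun p => Complex.conjCLE (Z p)) ht.1 hZ2
    (fun p _ => Complex.conjCLE.contDiff.contDiffAt.comp p (hZ2.contDiffAt.of_le (by norm_num)))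
    hZp (fun p => by rw [hZp])
  have hconj (p v : ℝ × ℝ) :
      fderiv ℝ (fun p => Complex.conjCLE (Z p)) p v = (starRingEnd ℂ) (fderiv ℝ Z p v) := by
    have := (Complex.conjCLE.hasFDerivAt.comp p
      (hZ2.differentiable (by norm_num) p).hasFDerivAt).fderiv
    exact congrArg (fun l => l v) this
  have hint (s : ℝ) (hs : s ∈ Ico 0 T) (φ : ℝ) :
      (starRingEnd ℂ) (fderiv ℝ Z (s, φ) (1, 0)) * fderiv ℝ Z (s, φ) (0, 1) -
        (starRingEnd ℂ) (fderiv ℝ Z (s, φ) (0, 1)) * fderiv ℝ Z (s, φ) (1, 0) =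
      (-2 * Complex.I) * ((fq n (z s) φ * ‖deriv (z s) φ‖ : ℝ) : ℂ) := by
    have hN : ‖deriv (z s) φ‖ ≠ 0 := norm_ne_zero_iff.2 (hreg s hs φ)
    have hN2 := Complex.sq_norm (deriv (z s) φ)
    rw [Complex.normSq_apply] at hN2
    have hd : fderiv ℝ Z (s, φ) (0, 1) = deriv (z s) φ := by rw [hzφ]
    rw [← hzt, hflow s hs φ, hd]
    apply Complex.ext
    · simp [nu]
      ring
    · simp [nu]
      field_simp
      rw [hN2]
      ring
  have hdouble : (∫ s in (0:ℝ)..t, ∫ φ in (0:ℝ)..(2 * π),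
      ((starRingEnd ℂ) (fderiv ℝ Z (s, φ) (1, 0)) * fderiv ℝ Z (s, φ) (0, 1) -
        (starRingEnd ℂ) (fderiv ℝ Z (s, φ) (0, 1)) * fderiv ℝ Z (s, φ) (1, 0))) =
      t * ((-2 * Complex.I) *
        ((∫ φ in (0:ℝ)..(2 * π), fq n (z 0) φ * ‖deriv (z 0) φ‖ : ℝ) : ℂ)) := by
    rw [intervalIntegral.integral_congr (g := fun _ => (-2 * Complex.I) *
        ((∫ φ in (0:ℝ)..(2 * π), fq n (z 0) φ * ‖deriv (z 0) φ‖ : ℝ) : ℂ))]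
    · simp only [intervalIntegral.integral_const, sub_zero, Complex.real_smul]
    · intro s hs
      rw [uIcc_of_le ht.1] at hs
      have hs' : s ∈ Ico 0 T := ⟨hs.1, hs.2.trans_lt ht.2⟩
      simp only [hint s hs']
      rw [intervalIntegral.integral_const_mul, intervalIntegral.integral_ofReal, hIconst s hs']
  simp only [hconj] at green
  rw [hdouble] at green
  have him (s : ℝ) :
      (∫ φ in (0:ℝ)..(2 * π), ((starRingEnd ℂ) (z s φ) * deriv (z s) φ).im) =
        (∫ φ in (0:ℝ)..(2 * π), Complex.conjCLE (Z (s, φ)) * fderiv ℝ Z (s, φ) (0, 1)).im := by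
    have h : Continuous fun φ => Complex.conjCLE (Z (s, φ)) * fderiv ℝ Z (s, φ) (0, 1) :=
      (Complex.conjCLE.continuous.comp (hZ2.continuous.comp (by fun_prop))).mul
        ((hcont Z hZ2 _).comp (by fun_prop))
    refine Eq.trans ?_ (intervalIntegral.intervalIntegral_im (h.intervalIntegrable _ _))
    simp only [hzφ]
    rfl
  have := congrArg Complex.im green
  rw [Complex.sub_im, ← him, ← him] at this
  rw [Complex.im_ofReal_mul, Complex.im_mul_ofReal,
    show (-2 * Complex.I).im = -2 by simp] at this
  linarith
end

section
/- Let n ≥ 1, let ε ∈ ℝ, and let z : ℝ → ℂ \ {0} be a smooth regular curve satisfying the self-similarity equation f = (ε/2)·⟨z,ν⟩ at every point. Then the quantity p := f · e^{−ε|z|²/4} · |z|^{n−1} is constant along the curve, i.e. ∂_φ ( f e^{−ε|z|²/4} |z|^{n−1} ) = 0 everywhere. -/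
open Real Set

/-- Derivative of the norm of a nonvanishing curve in ℂ. -/
theorem hasDerivAt_norm_curve {z : ℝ → ℂ} {w : ℂ} {φ : ℝ} (hz : HasDerivAt z w φ)
    (h0 : z φ ≠ 0) : HasDerivAt (fun ψ => ‖z ψ‖) (ip (z φ) w / ‖z φ‖) φ := by
  have hpos : 0 < ‖z φ‖ := norm_pos_iff.mpr h0
  have h := hz.norm_sq.sqrt (pow_pos hpos 2).ne'
  simp only [Real.sqrt_sq (norm_nonneg _)] at h
  refine h.congr_deriv ?_
  rw [Complex.inner, ip]
  simp only [Complex.mul_re, Complex.conj_re, Complex.conj_im]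
  field_simp
  ring

/-- Derivative of a natural power of the norm of a nonvanishing curve in ℂ. -/
theorem hasDerivAt_norm_pow_curve {z : ℝ → ℂ} {w : ℂ} {φ : ℝ} (hz : HasDerivAt z w φ)
    (h0 : z φ ≠ 0) (m : ℕ) :
    HasDerivAt (fun ψ => ‖z ψ‖ ^ m) (m * ip (z φ) w / ‖z φ‖ ^ 2 * ‖z φ‖ ^ m) φ := by
  have hpos : 0 < ‖z φ‖ := norm_pos_iff.mpr h0
  refine ((hasDerivAt_norm_curve hz h0).pow m).congr_deriv ?_
  cases m with
  | zero => simp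
  | succ k =>
    rw [Nat.add_sub_cancel]
    field_simp
    ring

theorem ip_nu (z : ℝ → ℂ) (φ : ℝ) :
    ip (z φ) (nu z φ) =
      ((z φ).re * (deriv z φ).im - (z φ).im * (deriv z φ).re) / ‖deriv z φ‖ := by
  simp only [ip, nu, Complex.smul_re, Complex.smul_im, smul_eq_mul]
  ring

/-- The support function satisfies `∂_φ ⟨z,ν⟩ = k ⟨z, ∂_φ z⟩`. -/
theorem hasDerivAt_ip_nu {z : ℝ → ℂ} {φ : ℝ} (hz : DifferentiableAt ℝ z φ)
    (hz' : DifferentiableAt ℝ (deriv z) φ) (hreg : deriv z φ ≠ 0) :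
    HasDerivAt (fun ψ => ip (z ψ) (nu z ψ)) (curv z φ * ip (z φ) (deriv z φ)) φ := by
  have hpos : 0 < ‖deriv z φ‖ := norm_pos_iff.mpr hreg
  have hsq : ‖deriv z φ‖ ^ 2 = (deriv z φ).re ^ 2 + (deriv z φ).im ^ 2 := by
    rw [Complex.sq_norm, Complex.normSq_apply]; ring
  have re_part {g : ℝ → ℂ} (hg : DifferentiableAt ℝ g φ) :
      HasDerivAt (fun ψ => (g ψ).re) (deriv g φ).re φ :=
    Complex.reCLM.hasFDerivAt.comp_hasDerivAt φ hg.hasDerivAt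
  have im_part {g : ℝ → ℂ} (hg : DifferentiableAt ℝ g φ) :
      HasDerivAt (fun ψ => (g ψ).im) (deriv g φ).im φ :=
    Complex.imCLM.hasFDerivAt.comp_hasDerivAt φ hg.hasDerivAt
  simp only [ip_nu]
  refine ((((re_part hz).mul (im_part hz')).sub ((im_part hz).mul (re_part hz'))).div
    (hasDerivAt_norm_curve hz'.hasDerivAt hreg) hpos.ne').congr_deriv ?_
  simp only [Pi.mul_apply, Pi.sub_apply, curv, ip]
  field_simp
  rw [hsq]
  ring

/-- On a self-similar solution (f = (ε/2)⟨z,ν⟩) the quantity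
p = f·e^{−ε|z|²/4}·|z|^{n−1} is constant along the curve. -/
theorem selfsimilar_invariant (n : ℕ) (hn : 1 ≤ n) (ε : ℝ) (z : ℝ → ℂ)
    (hsm : ContDiff ℝ (⊤ : ℕ∞) z) (hreg : ∀ φ, deriv z φ ≠ 0) (hnz : ∀ φ, z φ ≠ 0)
    (hss : ∀ φ, fq n z φ = ε / 2 * ip (z φ) (nu z φ)) :
    ∀ φ : ℝ,
      deriv (fun ψ => fq n z ψ * Real.exp (-ε * ‖z ψ‖ ^ 2 / 4) * ‖z ψ‖ ^ (n - 1)) φ = 0 := by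
  intro φ
  have hz : DifferentiableAt ℝ z φ := hsm.differentiable (by simp) φ
  have hz' : DifferentiableAt ℝ (deriv z) φ :=
    (contDiff_infty_iff_deriv.mp hsm).2.differentiable (by simp) φ
  have hpos : 0 < ‖z φ‖ := norm_pos_iff.mpr (hnz φ)
  have hcurv : curv z φ = ε / 2 * ip (z φ) (nu z φ)
      - ((n : ℝ) - 1) * ip (z φ) (nu z φ) / ‖z φ‖ ^ 2 := by
    rw [← hss φ, fq]; ring
  have hpow := hasDerivAt_norm_pow_curve hz.hasDerivAt (hnz φ)
  simp only [hss]
  refine (((((hasDerivAt_ip_nu hz hz' (hreg φ)).const_mul (ε / 2)).mul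
    (((hpow 2).const_mul (-ε)).div_const 4).exp).mul (hpow (n - 1))).congr_deriv ?_).deriv
  simp only [Pi.mul_apply]
  rw [hcurv, Nat.cast_sub hn]
  push_cast
  field_simp
  ring
end
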